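/- For the elephant random walk remembering only the two most recent steps: S_n/n → 0 almost surely as n → ∞, and S_n/(σ₂√n) converges in distribution to a standard normal random variable as n → ∞, where σ₂² = 1 + (2p−1)(5−2p)/(2(1−p)(3−2p)). -/

import Mathlib

open MeasureTheory ProbabilityTheory Filter Topology

noncomputable section

/-- The σ-algebra generated by the steps `X 1, …, X n`. -/
def sigmaUpTo {Ω : Type*} (X : ℕ → Ω → ℝ) (n : ℕ) : MeasurableSpace Ω :=
  ⨆ i ∈ Finset.Icc 1 n, MeasurableSpace.comap (X i) inferInstance

/-- The σ-algebra generated by all the steps `X 1, X 2, …`. -/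
def sigmaAll {Ω : Type*} (X : ℕ → Ω → ℝ) : MeasurableSpace Ω :=
  ⨆ i ∈ Set.Ici 1, MeasurableSpace.comap (X i) inferInstance

/-- The partial sum `X 1 + ⋯ + X n` of the walk. -/
def partialSum {Ω : Type*} (X : ℕ → Ω → ℝ) (n : ℕ) (ω : Ω) : ℝ :=
  ∑ k ∈ Finset.Icc 1 n, X k ω

/-- Convergence in distribution of the random variables `f n` to the law `ν`,
expressed as weak convergence tested against bounded continuous functions. -/
def TendstoInDistribution {Ω : Type*} [MeasurableSpace Ω] (μ : Measure Ω)
    (f : ℕ → Ω → ℝ) (ν : Measure ℝ) : Prop :=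
  ∀ g : BoundedContinuousFunction ℝ ℝ,
    Tendsto (fun n => ∫ ω, g (f n ω) ∂μ) atTop (𝓝 (∫ x, g x ∂ν))


/-- Nonnegative integrable functions with summable integrals are almost everywhere summable. -/
lemma ae_summable_of_summable_integral {Ω : Type*} [MeasurableSpace Ω] {μ : Measure Ω}
    {F : ℕ → Ω → ℝ} (hF : ∀ n ω, 0 ≤ F n ω) (h_int : ∀ n, Integrable (F n) μ)
    (hsum : Summable fun n => ∫ ω, F n ω ∂μ) : ∀ᵐ ω ∂μ, Summable fun n => F n ω := by
  have hmeas : ∀ n, AEMeasurable (fun ω => ENNReal.ofReal (F n ω)) μ :=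
    fun n => (h_int n).aemeasurable.ennreal_ofReal
  have hfin : ∫⁻ ω, ∑' n, ENNReal.ofReal (F n ω) ∂μ ≠ ⊤ := by
    rw [lintegral_tsum hmeas]
    simp_rw [← fun n => ofReal_integral_eq_lintegral_ofReal (h_int n) (ae_of_all _ (hF n))]
    exact hsum.tsum_ofReal_ne_top
  filter_upwards [ae_lt_top' (AEMeasurable.tsum hmeas) hfin] with ω hω
  exact (ENNReal.summable_toReal hω.ne).congr fun n => (ENNReal.toReal_ofReal (hF n ω))

/-- A process with bounded increments is almost surely of linear growth. -/
lemma ae_abs_le_of_bounded_increments {Ω : Type*} [MeasurableSpace Ω] {μ : Measure Ω}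
    {V : ℕ → Ω → ℝ} {K : ℝ} (h0 : ∀ᵐ ω ∂μ, |V 0 ω| ≤ K)
    (hD : ∀ k, ∀ᵐ ω ∂μ, |V (k + 1) ω - V k ω| ≤ K) (k : ℕ) :
    ∀ᵐ ω ∂μ, |V k ω| ≤ K * (k + 1) := by
  induction k with
  | zero => simpa using h0
  | succ k ih =>
    filter_upwards [ih, hD k] with ω h1 h2
    have := abs_add_le (V k ω) (V (k + 1) ω - V k ω)
    rw [add_sub_cancel] at this
    push_cast
    linarith

/-- A process with bounded increments `D k` such that `D k` is orthogonal to `V k` and `V k ^ 3`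
satisfies the strong law of large numbers. -/
lemma ae_tendsto_div_of_orthogonal_increments {Ω : Type*} [MeasurableSpace Ω] {μ : Measure Ω}
    [IsProbabilityMeasure μ] {V : ℕ → Ω → ℝ} {K : ℝ} (hV : ∀ k, Measurable (V k))
    (h0 : ∀ᵐ ω ∂μ, |V 0 ω| ≤ K) (hD : ∀ k, ∀ᵐ ω ∂μ, |V (k + 1) ω - V k ω| ≤ K)
    (h1 : ∀ k, ∫ ω, V k ω * (V (k + 1) ω - V k ω) ∂μ = 0)
    (h3 : ∀ k, ∫ ω, V k ω ^ 3 * (V (k + 1) ω - V k ω) ∂μ = 0) :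
    ∀ᵐ ω ∂μ, Tendsto (fun n : ℕ => V n ω / (n + 1)) atTop (𝓝 0) := by
  have hbd := ae_abs_le_of_bounded_increments h0 hD
  have h_int : ∀ k m, Integrable (fun ω => V k ω ^ m) μ := fun k m =>
    .of_bound (by fun_prop) ((K * (k + 1)) ^ m) <| by
      filter_upwards [hbd k] with ω h
      rw [norm_pow, Real.norm_eq_abs]
      gcongr
  have hintD : ∀ k m, Integrable (fun ω => V k ω ^ m * (V (k + 1) ω - V k ω)) μ := fun k m =>
    .of_bound (by fun_prop) ((K * (k + 1)) ^ m * K) <| by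
      filter_upwards [hbd k, hD k] with ω h h'
      have h_nn := (abs_nonneg _).trans h
      rw [norm_mul, norm_pow, Real.norm_eq_abs, Real.norm_eq_abs]
      gcongr
  have hsq : ∀ k : ℕ, ∫ ω, V k ω ^ 2 ∂μ ≤ K ^ 2 * (k + 1) := by
    intro k
    induction k with
    | zero =>
      have : ∫ ω, V 0 ω ^ 2 ∂μ ≤ ∫ _, K ^ 2 ∂μ := by
        refine integral_mono_ae (h_int 0 2) (integrable_const _) ?_
        filter_upwards [h0] with ω h
        exact sq_le_sq' (abs_le.1 h).1 (abs_le.1 h).2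
      simpa using this
    | succ k ih =>
      have : ∫ ω, V (k + 1) ω ^ 2 ∂μ ≤
          ∫ ω, (V k ω ^ 2 + 2 * (V k ω ^ 1 * (V (k + 1) ω - V k ω)) + K ^ 2) ∂μ := by
        refine integral_mono_ae (h_int _ 2)
          (((h_int k 2).fun_add ((hintD k 1).const_mul 2)).fun_add (integrable_const _)) ?_
        filter_upwards [hD k] with ω h
        have := sq_le_sq' (abs_le.1 h).1 (abs_le.1 h).2
        nlinarith
      rw [integral_add ((h_int k 2).fun_add ((hintD k 1).const_mul 2)) (integrable_const _),
        integral_add (h_int k 2) ((hintD k 1).const_mul 2), integral_const_mul] at this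
      simp only [pow_one, h1, integral_const, probReal_univ, one_smul] at this
      push_cast
      linarith
  have hfour : ∀ k : ℕ, ∫ ω, V k ω ^ 4 ∂μ ≤ 11 * K ^ 4 * (k + 1) ^ 2 := by
    intro k
    have hK4 : 0 ≤ K ^ 4 := by positivity
    induction k with
    | zero =>
      have : ∫ ω, V 0 ω ^ 4 ∂μ ≤ ∫ _, K ^ 4 ∂μ := by
        refine integral_mono_ae (h_int 0 4) (integrable_const _) ?_
        filter_upwards [h0] with ω h
        have := pow_le_pow_left₀ (abs_nonneg _) h 4
        rwa [Even.pow_abs (by decide)] at this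
      simp at this ⊢
      linarith
    | succ k ih =>
      have : ∫ ω, V (k + 1) ω ^ 4 ∂μ ≤
          ∫ ω, (V k ω ^ 4 + 4 * (V k ω ^ 3 * (V (k + 1) ω - V k ω))
            + (8 * K ^ 2) * V k ω ^ 2 + 3 * K ^ 4) ∂μ := by
        refine integral_mono_ae (h_int _ 4) ((((h_int k 4).fun_add ((hintD k 3).const_mul 4)).fun_add
          ((h_int k 2).const_mul _)).fun_add (integrable_const _)) ?_
        filter_upwards [hD k] with ω h
        have hD2 := sq_le_sq' (abs_le.1 h).1 (abs_le.1 h).2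
        set v := V k ω
        set d := V (k + 1) ω - v with hd
        have hw : V (k + 1) ω = v + d := by rw [hd]; ring
        rw [hw]
        have e1 : v ^ 2 * d ^ 2 ≤ v ^ 2 * K ^ 2 := by gcongr
        have e2 : (d ^ 2) ^ 2 ≤ (K ^ 2) ^ 2 := by gcongr
        nlinarith [sq_nonneg (v * d - d ^ 2)]
      rw [integral_add (((h_int k 4).fun_add ((hintD k 3).const_mul 4)).fun_add ((h_int k 2).const_mul _))
          (integrable_const _),
        integral_add ((h_int k 4).fun_add ((hintD k 3).const_mul 4)) ((h_int k 2).const_mul _),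
        integral_add (h_int k 4) ((hintD k 3).const_mul 4), integral_const_mul,
        integral_const_mul] at this
      simp only [h3, integral_const, probReal_univ, one_smul] at this
      have h2 := mul_le_mul_of_nonneg_left (hsq k) (show 0 ≤ 8 * K ^ 2 by positivity)
      push_cast
      nlinarith [mul_nonneg hK4 (Nat.cast_nonneg (α := ℝ) k)]
  have hsum : Summable fun n : ℕ => ∫ ω, (V n ω / (n + 1)) ^ 4 ∂μ := by
    refine .of_nonneg_of_le (fun n => integral_nonneg fun ω => by positivity) (fun n => ?_)
      (((summable_nat_add_iff 1).2 (Real.summable_nat_pow_inv.2 one_lt_two)).mul_left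
        (11 * K ^ 4))
    simp_rw [div_pow]
    rw [integral_div, div_le_iff₀ (by positivity)]
    refine (hfour n).trans_eq ?_
    push_cast
    field_simp
  have hae := ae_summable_of_summable_integral (fun n ω => by positivity)
    (fun n => by simp_rw [div_pow]; exact (h_int n 4).div_const _) hsum
  filter_upwards [hae] with ω h
  have h4 := h.tendsto_atTop_zero
  have hroot := (h4.sqrt).sqrt
  simp only [Real.sqrt_zero] at hroot
  rw [tendsto_zero_iff_abs_tendsto_zero]
  refine hroot.congr fun n => ?_
  rw [show ∀ x : ℝ, x ^ 4 = (x ^ 2) ^ 2 by intro x; ring, Real.sqrt_sq (sq_nonneg _),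
    Real.sqrt_sq_eq_abs]
  rfl

/-- Second order expansion of a one-step increment of a corrected exponential. -/
lemma exists_norm_exp_increment_le (K c v : ℝ) (hK : 0 ≤ K) :
    ∃ C : ℝ, 0 ≤ C ∧ ∀ s D Y W : ℝ, |s| ≤ 1 → |D| ≤ K → |Y| ≤ 1 → |W| ≤ 1 →
      ‖Complex.exp (Complex.I * (s * D : ℝ)) * (1 + s ^ 2 * c * W : ℝ)
        - (1 - s ^ 2 * v / 2 : ℝ) * (1 + s ^ 2 * c * Y : ℝ)
        - (Complex.I * (s * D : ℝ) + (s ^ 2 * (-D ^ 2 / 2 + c * W + v / 2 - c * Y) : ℝ))‖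
        ≤ C * |s| ^ 3 := by
  refine ⟨K ^ 3 * Real.exp K * (1 + |c|) + K * |c| + K ^ 2 * |c| / 2 + |v| * |c| / 2,
    by positivity, fun s D Y W hs hD hY hY' => ?_⟩
  have hs0 := abs_nonneg s
  have hsD : |s * D| ≤ K := by
    rw [abs_mul]
    simpa using mul_le_mul hs hD (abs_nonneg D) zero_le_one
  have hR : ‖Complex.exp (Complex.I * (s * D : ℝ)) -
      (1 + Complex.I * (s * D : ℝ) - ((s * D) ^ 2 / 2 : ℝ))‖ ≤ |s| ^ 3 * (K ^ 3 * Real.exp K) := by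
    have h := Complex.norm_exp_sub_sum_le_norm_mul_exp (Complex.I * (s * D : ℝ)) 3
    have hn : ‖Complex.I * ((s * D : ℝ) : ℂ)‖ = |s * D| := by
      rw [norm_mul, Complex.norm_I, one_mul, Complex.norm_real, Real.norm_eq_abs]
    rw [hn] at h
    refine (le_of_eq ?_).trans (h.trans ?_)
    · congr 2
      simp only [Finset.sum_range_succ, Finset.sum_range_zero, mul_pow, Complex.I_sq]
      push_cast [Nat.factorial]
      ring
    · rw [abs_mul, mul_pow, mul_assoc]
      rw [abs_mul] at hsD
      gcongr
  set E := Complex.exp (Complex.I * (s * D : ℝ)) -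
      (1 + Complex.I * (s * D : ℝ) - ((s * D) ^ 2 / 2 : ℝ)) with hE
  have hexp : Complex.exp (Complex.I * (s * D : ℝ)) =
      E + (1 + Complex.I * (s * D : ℝ) - ((s * D) ^ 2 / 2 : ℝ)) := by rw [hE]; ring
  have key : Complex.exp (Complex.I * (s * D : ℝ)) * (1 + s ^ 2 * c * W : ℝ)
        - (1 - s ^ 2 * v / 2 : ℝ) * (1 + s ^ 2 * c * Y : ℝ)
        - (Complex.I * (s * D : ℝ) + (s ^ 2 * (-D ^ 2 / 2 + c * W + v / 2 - c * Y) : ℝ)) =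
      E * (1 + s ^ 2 * c * W : ℝ) + Complex.I * (s ^ 3 * (D * c * W) : ℝ)
        - (s ^ 4 * (D ^ 2 * c * W / 2) : ℝ) + (s ^ 4 * (v * c * Y / 2) : ℝ) := by
    rw [hexp]
    push_cast
    ring
  have hs2 : |s| ^ 2 ≤ 1 := pow_le_one₀ hs0 hs
  have hs4 : |s| ^ 4 ≤ |s| ^ 3 := pow_le_pow_of_le_one hs0 hs (by norm_num)
  have t1 : ‖E * (1 + s ^ 2 * c * W : ℝ)‖ ≤ |s| ^ 3 * (K ^ 3 * Real.exp K) * (1 + |c|) := by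
    rw [norm_mul]
    refine mul_le_mul hR ?_ (norm_nonneg _) (by positivity)
    rw [Complex.norm_real, Real.norm_eq_abs]
    refine (abs_add_le _ _).trans ?_
    rw [abs_one, abs_mul, abs_mul, abs_pow]
    have : |s| ^ 2 * |c| * |W| ≤ 1 * |c| * 1 := by gcongr
    linarith
  have t2 : ‖Complex.I * ((s ^ 3 * (D * c * W) : ℝ) : ℂ)‖ ≤ |s| ^ 3 * (K * |c|) := by
    rw [norm_mul, Complex.norm_I, one_mul, Complex.norm_real, Real.norm_eq_abs, abs_mul, abs_pow,
      abs_mul, abs_mul]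
    have : |D| * |c| * |W| ≤ K * |c| * 1 := by gcongr
    exact mul_le_mul_of_nonneg_left (by linarith) (by positivity)
  have t3 : ‖((s ^ 4 * (D ^ 2 * c * W / 2) : ℝ) : ℂ)‖ ≤ |s| ^ 3 * (K ^ 2 * |c| / 2) := by
    rw [Complex.norm_real, Real.norm_eq_abs, abs_mul, abs_pow, abs_div, abs_mul, abs_mul, abs_pow,
      abs_two]
    have : |D| ^ 2 * |c| * |W| ≤ K ^ 2 * |c| * 1 := by gcongr
    refine mul_le_mul hs4 (by linarith) (by positivity) (by positivity)
  have t4 : ‖((s ^ 4 * (v * c * Y / 2) : ℝ) : ℂ)‖ ≤ |s| ^ 3 * (|v| * |c| / 2) := by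
    rw [Complex.norm_real, Real.norm_eq_abs, abs_mul, abs_pow, abs_div, abs_mul, abs_mul, abs_two]
    have : |v| * |c| * |Y| ≤ |v| * |c| * 1 := by gcongr
    refine mul_le_mul hs4 (by linarith) (by positivity) (by positivity)
  rw [key]
  refine (norm_add_le _ _).trans ?_
  have n1 := norm_sub_le (E * (1 + s ^ 2 * c * W : ℝ) + Complex.I * (s ^ 3 * (D * c * W) : ℝ))
    ((s ^ 4 * (D ^ 2 * c * W / 2) : ℝ) : ℂ)
  have n2 := norm_add_le (E * (1 + s ^ 2 * c * W : ℝ)) (Complex.I * (s ^ 3 * (D * c * W) : ℝ))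
  linarith

/-- A central limit theorem for characteristic functions of a process `U` at bounded distance from a
process `V` with bounded increments, whose conditional variances are the constant `v` up to the
coboundary of the bounded process `2 * c * Y`. -/
lemma tendsto_integral_exp_of_corrected_increments {Ω : Type*} [MeasurableSpace Ω] {μ : Measure Ω}
    [IsProbabilityMeasure μ] {U V Y : ℕ → Ω → ℝ} {K c v : ℝ} (hK : 0 ≤ K) (hv : 0 ≤ v)
    (hU : ∀ k, Measurable (U k)) (hV : ∀ k, Measurable (V k)) (hY : ∀ k, Measurable (Y k))
    (hUV : ∀ k, ∀ᵐ ω ∂μ, |U k ω - V k ω| ≤ K)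
    (h0 : ∀ᵐ ω ∂μ, |V 0 ω| ≤ K) (hD : ∀ k, ∀ᵐ ω ∂μ, |V (k + 1) ω - V k ω| ≤ K)
    (hYb : ∀ k, ∀ᵐ ω ∂μ, |Y k ω| ≤ 1)
    (horth : ∀ k s, ∫ ω, Complex.exp (Complex.I * (s * V k ω : ℝ)) *
      (Complex.I * (s * (V (k + 1) ω - V k ω) : ℝ) +
        (s ^ 2 * (-(V (k + 1) ω - V k ω) ^ 2 / 2 + c * Y (k + 1) ω + v / 2 - c * Y k ω) : ℝ)) ∂μ
        = 0) (t : ℝ) :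
    Tendsto (fun n : ℕ => ∫ ω, Complex.exp (Complex.I * (t / √n * U n ω : ℝ)) ∂μ) atTop
      (𝓝 (Complex.exp (-(v * t ^ 2 / 2 : ℝ)))) := by
  obtain ⟨C, hC, hexp⟩ := exists_norm_exp_increment_le K c v hK
  have hnorm : ∀ x : ℝ, ‖Complex.exp (Complex.I * x)‖ = 1 := Complex.norm_exp_I_mul_ofReal
  set f : ℝ → ℕ → ℂ := fun s k =>
    ∫ ω, Complex.exp (Complex.I * (s * V k ω : ℝ)) * (1 + s ^ 2 * c * Y k ω : ℝ) ∂μ with hf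
  have hfint : ∀ s k, Integrable (fun ω =>
      Complex.exp (Complex.I * (s * V k ω : ℝ)) * (1 + s ^ 2 * c * Y k ω : ℝ)) μ := by
    intro s k
    refine .of_bound (by fun_prop) (1 + s ^ 2 * |c|) ?_
    filter_upwards [hYb k] with ω h
    rw [norm_mul, hnorm, one_mul, Complex.norm_real, Real.norm_eq_abs]
    refine (abs_add_le _ _).trans ?_
    rw [abs_one, abs_mul, abs_mul, abs_pow, sq_abs]
    have : s ^ 2 * |c| * |Y k ω| ≤ s ^ 2 * |c| * 1 := by gcongr
    linarith
  have hGint : ∀ s k, Integrable (fun ω => Complex.exp (Complex.I * (s * V k ω : ℝ)) *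
      (Complex.I * (s * (V (k + 1) ω - V k ω) : ℝ) +
        (s ^ 2 * (-(V (k + 1) ω - V k ω) ^ 2 / 2 + c * Y (k + 1) ω + v / 2 - c * Y k ω) : ℝ)))
      μ := by
    intro s k
    refine .of_bound (by fun_prop) (|s| * K + s ^ 2 * (K ^ 2 / 2 + |c| + v / 2 + |c|)) ?_
    filter_upwards [hYb k, hYb (k + 1), hD k] with ω h h' hd
    rw [norm_mul, hnorm, one_mul]
    refine (norm_add_le _ _).trans (add_le_add ?_ ?_)
    · rw [norm_mul, Complex.norm_I, one_mul, Complex.norm_real, Real.norm_eq_abs, abs_mul]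
      gcongr
    · rw [Complex.norm_real, Real.norm_eq_abs, abs_mul, abs_pow, sq_abs]
      gcongr
      have hd2 := sq_le_sq' (abs_le.1 hd).1 (abs_le.1 hd).2
      have b1 : |c * Y k ω| ≤ |c| := by
        rw [abs_mul]; exact mul_le_of_le_one_right (abs_nonneg _) h
      have b2 : |c * Y (k + 1) ω| ≤ |c| := by
        rw [abs_mul]; exact mul_le_of_le_one_right (abs_nonneg _) h'
      rw [abs_le] at b1 b2 ⊢
      have := sq_nonneg (V (k + 1) ω - V k ω)
      constructor <;> linarith [abs_nonneg c]
  have hstep : ∀ s k, |s| ≤ 1 → ‖f s (k + 1) - (1 - s ^ 2 * v / 2 : ℝ) * f s k‖ ≤ C * |s| ^ 3 := by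
    intro s k hs
    have heq : f s (k + 1) - (1 - s ^ 2 * v / 2 : ℝ) * f s k =
        ∫ ω, (Complex.exp (Complex.I * (s * V (k + 1) ω : ℝ)) * (1 + s ^ 2 * c * Y (k + 1) ω : ℝ)
          - (1 - s ^ 2 * v / 2 : ℝ) *
            (Complex.exp (Complex.I * (s * V k ω : ℝ)) * (1 + s ^ 2 * c * Y k ω : ℝ))
          - Complex.exp (Complex.I * (s * V k ω : ℝ)) *
      (Complex.I * (s * (V (k + 1) ω - V k ω) : ℝ) +
        (s ^ 2 * (-(V (k + 1) ω - V k ω) ^ 2 / 2 + c * Y (k + 1) ω + v / 2 - c * Y k ω) : ℝ)))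
          ∂μ := by
      have hdint : Integrable (fun ω =>
          Complex.exp (Complex.I * (s * V (k + 1) ω : ℝ)) * (1 + s ^ 2 * c * Y (k + 1) ω : ℝ)
          - (1 - s ^ 2 * v / 2 : ℝ) *
            (Complex.exp (Complex.I * (s * V k ω : ℝ)) * (1 + s ^ 2 * c * Y k ω : ℝ))) μ :=
        (hfint s (k + 1)).sub ((hfint s k).const_mul _)
      rw [integral_sub hdint (hGint s k), horth,
        sub_zero, integral_sub (hfint s (k + 1)) ((hfint s k).const_mul _), integral_const_mul]
    rw [heq]
    refine (norm_integral_le_of_norm_le_const (C := C * |s| ^ 3) ?_).trans_eq (by simp)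
    filter_upwards [hYb k, hYb (k + 1), hD k] with ω h h' hd
    have hfac : Complex.exp (Complex.I * (s * V (k + 1) ω : ℝ)) =
        Complex.exp (Complex.I * (s * V k ω : ℝ)) *
          Complex.exp (Complex.I * (s * (V (k + 1) ω - V k ω) : ℝ)) := by
      rw [← Complex.exp_add]
      congr 1
      push_cast
      ring
    refine le_trans (le_of_eq ?_) (hexp s _ _ _ hs hd h h')
    rw [← one_mul ‖_ - _ - (_ + _)‖, ← hnorm (s * V k ω), ← norm_mul, hfac]
    congr 1
    ring
  have hiter : ∀ s, |s| ≤ 1 → s ^ 2 * v / 2 ≤ 1 → ∀ n : ℕ,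
      ‖f s n - ((1 - s ^ 2 * v / 2) ^ n : ℝ) * f s 0‖ ≤ n * (C * |s| ^ 3) := by
    intro s hs hsv n
    have hr0 : 0 ≤ 1 - s ^ 2 * v / 2 := by linarith
    have hr1 : 1 - s ^ 2 * v / 2 ≤ 1 := by
      have : 0 ≤ s ^ 2 * v / 2 := by positivity
      linarith
    induction n with
    | zero => simp
    | succ n ih =>
      have heq : f s (n + 1) - ((1 - s ^ 2 * v / 2) ^ (n + 1) : ℝ) * f s 0 =
          (f s (n + 1) - (1 - s ^ 2 * v / 2 : ℝ) * f s n) + (1 - s ^ 2 * v / 2 : ℝ) *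
            (f s n - ((1 - s ^ 2 * v / 2) ^ n : ℝ) * f s 0) := by
        push_cast
        ring
      rw [heq]
      refine (norm_add_le _ _).trans ?_
      have h2 : ‖((1 - s ^ 2 * v / 2 : ℝ) : ℂ) *
          (f s n - ((1 - s ^ 2 * v / 2) ^ n : ℝ) * f s 0)‖ ≤ n * (C * |s| ^ 3) := by
        rw [norm_mul, Complex.norm_real, Real.norm_of_nonneg hr0]
        exact (mul_le_of_le_one_left (norm_nonneg _) hr1).trans ih
      have h1 := hstep s n hs
      push_cast
      push_cast at h1 h2
      linarith
  have hclose : ∀ (s : ℝ) k (Z : Ω → ℝ), Measurable Z → (∀ᵐ ω ∂μ, |Z ω - V k ω| ≤ K) →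
      ‖∫ ω, Complex.exp (Complex.I * (s * Z ω : ℝ)) ∂μ - f s k‖ ≤ |s| * K + s ^ 2 * |c| := by
    intro s k Z hZ hZV
    have hZint : Integrable (fun ω => Complex.exp (Complex.I * (s * Z ω : ℝ))) μ :=
      .of_bound (by fun_prop) 1 (ae_of_all _ fun ω => (hnorm _).le)
    rw [hf, ← integral_sub hZint (hfint s k)]
    refine (norm_integral_le_of_norm_le_const (C := |s| * K + s ^ 2 * |c|) ?_).trans_eq (by simp)
    filter_upwards [hYb k, hZV] with ω h hz
    have heq : Complex.exp (Complex.I * (s * Z ω : ℝ)) -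
        Complex.exp (Complex.I * (s * V k ω : ℝ)) * (1 + s ^ 2 * c * Y k ω : ℝ) =
        Complex.exp (Complex.I * (s * V k ω : ℝ)) *
          ((Complex.exp (Complex.I * (s * (Z ω - V k ω) : ℝ)) - 1) - (s ^ 2 * c * Y k ω : ℝ)) := by
      have hfac : Complex.exp (Complex.I * (s * Z ω : ℝ)) =
          Complex.exp (Complex.I * (s * V k ω : ℝ)) *
            Complex.exp (Complex.I * (s * (Z ω - V k ω) : ℝ)) := by
        rw [← Complex.exp_add]
        congr 1
        push_cast
        ring
      rw [hfac]
      push_cast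
      ring
    rw [heq, norm_mul, hnorm, one_mul]
    refine (norm_sub_le _ _).trans (add_le_add ?_ ?_)
    · refine Real.norm_exp_I_mul_ofReal_sub_one_le.trans ?_
      rw [Real.norm_eq_abs, abs_mul]
      gcongr
    · rw [Complex.norm_real, Real.norm_eq_abs, abs_mul, abs_mul, abs_pow, sq_abs]
      exact mul_le_of_le_one_right (by positivity) h
  have hbound : ∀ s, |s| ≤ 1 → s ^ 2 * v / 2 ≤ 1 → ∀ n : ℕ,
      ‖∫ ω, Complex.exp (Complex.I * (s * U n ω : ℝ)) ∂μ - ((1 - s ^ 2 * v / 2) ^ n : ℝ)‖ ≤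
        n * (C * |s| ^ 3) + 2 * (|s| * K + s ^ 2 * |c|) := by
    intro s hs hsv n
    have hr0 : 0 ≤ 1 - s ^ 2 * v / 2 := by linarith
    have hr1 : 1 - s ^ 2 * v / 2 ≤ 1 := by
      have : 0 ≤ s ^ 2 * v / 2 := by positivity
      linarith
    have b1 := hclose s n (U n) (hU n) (hUV n)
    have b2 := hiter s hs hsv n
    have b3 : ‖((1 - s ^ 2 * v / 2) ^ n : ℝ) * (1 - f s 0)‖ ≤ |s| * K + s ^ 2 * |c| := by
      have h := hclose s 0 (fun _ => 0) measurable_const (by simpa using h0)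
      simp only [mul_zero, Complex.ofReal_zero, Complex.exp_zero, integral_const, probReal_univ,
        one_smul] at h
      rw [norm_mul, Complex.norm_real, Real.norm_of_nonneg (pow_nonneg hr0 n)]
      exact (mul_le_of_le_one_left (norm_nonneg _) (pow_le_one₀ hr0 hr1)).trans h
    have heq : ∫ ω, Complex.exp (Complex.I * (s * U n ω : ℝ)) ∂μ -
        ((1 - s ^ 2 * v / 2) ^ n : ℝ) =
        (∫ ω, Complex.exp (Complex.I * (s * U n ω : ℝ)) ∂μ - f s n) +
        (f s n - ((1 - s ^ 2 * v / 2) ^ n : ℝ) * f s 0)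
          - ((1 - s ^ 2 * v / 2) ^ n : ℝ) * (1 - f s 0) := by ring
    rw [heq]
    refine (norm_sub_le _ _).trans ?_
    have := norm_add_le (∫ ω, Complex.exp (Complex.I * (s * U n ω : ℝ)) ∂μ - f s n)
      (f s n - ((1 - s ^ 2 * v / 2) ^ n : ℝ) * f s 0)
    linarith
  have hs0 : Tendsto (fun n : ℕ => t / √n) atTop (𝓝 0) :=
    tendsto_const_nhds.div_atTop (Real.tendsto_sqrt_atTop.comp tendsto_natCast_atTop_atTop)
  have hnsq : ∀ᶠ n : ℕ in atTop, (n : ℝ) * (t / √n) ^ 2 = t ^ 2 := by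
    filter_upwards [eventually_gt_atTop 0] with n hn
    rw [div_pow, Real.sq_sqrt (Nat.cast_nonneg n)]
    field_simp
  have hpow : Tendsto (fun n : ℕ => (((1 - (t / √n) ^ 2 * v / 2) ^ n : ℝ) : ℂ)) atTop
      (𝓝 (Complex.exp (-(v * t ^ 2 / 2 : ℝ)))) := by
    rw [← Complex.ofReal_neg, ← Complex.ofReal_exp]
    refine (Complex.continuous_ofReal.tendsto _).comp ?_
    simp_rw [sub_eq_add_neg]
    refine Real.tendsto_one_add_pow_exp_of_tendsto (tendsto_const_nhds.congr' ?_)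
    filter_upwards [hnsq] with n hn
    rw [← hn]
    ring
  have herr : Tendsto (fun n : ℕ => n * (C * |t / √n| ^ 3) +
      2 * (|t / √n| * K + (t / √n) ^ 2 * |c|)) atTop (𝓝 0) := by
    have h : Tendsto (fun n : ℕ => t ^ 2 * (C * |t / √n|) +
        2 * (|t / √n| * K + (t / √n) ^ 2 * |c|)) atTop (𝓝 0) := by
      have := (((hs0.abs.const_mul C).const_mul (t ^ 2))).add
        (((hs0.abs.mul_const K).add ((hs0.pow 2).mul_const |c|)).const_mul 2)
      simpa using this
    refine h.congr' ?_
    filter_upwards [hnsq] with n hn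
    rw [← hn, pow_succ |t / √n|, sq_abs]
    ring
  have hdiff : Tendsto (fun n : ℕ => ∫ ω, Complex.exp (Complex.I * (t / √n * U n ω : ℝ)) ∂μ -
      ((1 - (t / √n) ^ 2 * v / 2) ^ n : ℝ)) atTop (𝓝 0) := by
    refine squeeze_zero_norm' ?_ herr
    have hsmall : ∀ᶠ n : ℕ in atTop, |t / √n| ≤ 1 :=
      (by simpa using hs0.abs : Tendsto (fun n : ℕ => |t / √n|) atTop (𝓝 0)).eventually_le_const
        one_pos
    have hsmall' : ∀ᶠ n : ℕ in atTop, (t / √n) ^ 2 * v / 2 ≤ 1 := by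
      have : Tendsto (fun n : ℕ => (t / √n) ^ 2 * v / 2) atTop (𝓝 0) := by
        simpa using ((hs0.pow 2).mul_const v).div_const 2
      exact this.eventually_le_const one_pos
    filter_upwards [hsmall, hsmall'] with n h1 h2
    exact hbound _ h1 h2 n
  simpa using hdiff.add hpow

/-- The step `X (k + 3)` centred by its conditional expectation given the past. -/
def innovation {Ω : Type*} (X : ℕ → Ω → ℝ) (q : ℝ) (k : ℕ) (ω : Ω) : ℝ :=
  X (k + 3) ω - q * (X (k + 1) ω + X (k + 2) ω) / 2

/-- The martingale obtained by adding to the walk a combination of its two most recent steps. -/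
def correctedWalk {Ω : Type*} (X : ℕ → Ω → ℝ) (q : ℝ) (k : ℕ) (ω : Ω) : ℝ :=
  partialSum X (k + 2) ω + q / (1 - q) * X (k + 2) ω + q / (1 - q) / 2 * X (k + 1) ω

lemma partialSum_succ {Ω : Type*} (X : ℕ → Ω → ℝ) (n : ℕ) (ω : Ω) :
    partialSum X (n + 1) ω = partialSum X n ω + X (n + 1) ω :=
  Finset.sum_Icc_succ_top (by omega) _

lemma correctedWalk_succ_sub {Ω : Type*} (X : ℕ → Ω → ℝ) {q : ℝ} (hq : q < 1) (k : ℕ) (ω : Ω) :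
    correctedWalk X q (k + 1) ω - correctedWalk X q k ω = (1 - q)⁻¹ * innovation X q k ω := by
  have h : 1 - q ≠ 0 := by linarith
  simp only [correctedWalk, innovation, partialSum_succ, add_assoc, Nat.reduceAdd]
  field_simp
  ring

lemma stronglyMeasurable_sigmaUpTo {Ω : Type*} (X : ℕ → Ω → ℝ) {i n : ℕ} (h1 : 1 ≤ i)
    (hn : i ≤ n) : StronglyMeasurable[sigmaUpTo X n] (X i) :=
  (Measurable.mono (comap_measurable (X i))
    (le_biSup (fun i => MeasurableSpace.comap (X i) inferInstance) (Finset.mem_Icc.2 ⟨h1, hn⟩))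
    le_rfl).stronglyMeasurable

lemma sigmaUpTo_le {Ω : Type*} [m : MeasurableSpace Ω] {X : ℕ → Ω → ℝ}
    (hX : ∀ i, Measurable (X i)) (n : ℕ) : sigmaUpTo X n ≤ m :=
  iSup₂_le fun i _ => (hX i).comap_le

lemma stronglyMeasurable_correctedWalk {Ω : Type*} (X : ℕ → Ω → ℝ) (q : ℝ) (k : ℕ) :
    StronglyMeasurable[sigmaUpTo X (k + 2)] (correctedWalk X q k) := by
  have hS : StronglyMeasurable[sigmaUpTo X (k + 2)] (partialSum X (k + 2)) :=
    Finset.stronglyMeasurable_fun_sum _ fun i hi =>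
      stronglyMeasurable_sigmaUpTo X (Finset.mem_Icc.1 hi).1 (Finset.mem_Icc.1 hi).2
  exact (hS.add ((stronglyMeasurable_sigmaUpTo X (by omega) le_rfl).const_mul _)).add
    ((stronglyMeasurable_sigmaUpTo X (by omega) (by omega)).const_mul _)

/-- The innovations are orthogonal to bounded functions of the past. -/
lemma integral_innovation_smul_eq_zero {Ω E : Type*} [MeasurableSpace Ω] [NormedAddCommGroup E]
    [NormedSpace ℝ E] [CompleteSpace E] {μ : Measure Ω} [IsProbabilityMeasure μ]
    {X : ℕ → Ω → ℝ} {q : ℝ} (hX : ∀ i, Measurable (X i))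
    (hval : ∀ i, 1 ≤ i → ∀ᵐ ω ∂μ, X i ω = 1 ∨ X i ω = -1) {k : ℕ}
    (hcond : μ[X (k + 3) | sigmaUpTo X (k + 2)] =ᵐ[μ]
      fun ω => q * (X (k + 1) ω + X (k + 2) ω) / 2)
    {g : Ω → E} (hg : StronglyMeasurable[sigmaUpTo X (k + 2)] g) {C : ℝ}
    (hC : ∀ᵐ ω ∂μ, ‖g ω‖ ≤ C) : ∫ ω, innovation X q k ω • g ω ∂μ = 0 := by
  have hm := sigmaUpTo_le hX (k + 2)
  have habs : ∀ i, 1 ≤ i → ∀ᵐ ω ∂μ, ‖X i ω‖ ≤ 1 := fun i hi => by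
    filter_upwards [hval i hi] with ω h
    rcases h with h | h <;> simp [h]
  have hXint : ∀ i, 1 ≤ i → Integrable (X i) μ := fun i hi =>
    .of_bound (hX i).aestronglyMeasurable 1 (habs i hi)
  have hgm : AEStronglyMeasurable g μ := (hg.mono hm).aestronglyMeasurable
  have hgint : ∀ i, 1 ≤ i → Integrable (fun ω => X i ω • g ω) μ := fun i hi => by
    refine .of_bound ((hX i).aestronglyMeasurable.smul hgm) C ?_
    filter_upwards [habs i hi, hC] with ω h h'
    rw [norm_smul]
    exact (mul_le_of_le_one_left (norm_nonneg _) h).trans h'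
  have hpull := condExp_bilin_of_stronglyMeasurable_left (m := sigmaUpTo X (k + 2))
    (ContinuousLinearMap.lsmul ℝ ℝ (E := E)).flip hg (hgint (k + 3) (by omega))
    (hXint (k + 3) (by omega))
  have h1 : ∫ ω, X (k + 3) ω • g ω ∂μ = ∫ ω, (q * (X (k + 1) ω + X (k + 2) ω) / 2) • g ω ∂μ := by
    rw [← integral_condExp hm]
    refine integral_congr_ae ?_
    filter_upwards [hpull, hcond] with ω h h'
    rw [h'] at h
    exact h
  have h_int : Integrable (fun ω => (q * (X (k + 1) ω + X (k + 2) ω) / 2) • g ω) μ := by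
    refine (((hgint (k + 1) (by omega)).add (hgint (k + 2) (by omega))).smul (q / 2)).congr ?_
    refine ae_of_all _ fun ω => ?_
    simp only [Pi.smul_apply, Pi.add_apply, ← add_smul, smul_smul]
    congr 1
    ring
  simp_rw [innovation, sub_smul]
  rw [integral_sub (hgint (k + 3) (by omega)) h_int, h1, sub_self]

/-- With steps `±1`, the second order term of the corrected exponential is a multiple of the
innovation `x - q * (z + y) / 2`. -/
lemma second_order_term_eq {A q c v x y z : ℝ} (hc : c * (2 - q) = A ^ 2 * q ^ 2 / 2)
    (hv : v = A ^ 2 * (1 - q ^ 2 / 2) - c * q) (hx : x = 1 ∨ x = -1) (hy : y = 1 ∨ y = -1)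
    (hz : z = 1 ∨ z = -1) :
    -(A * (x - q * (z + y) / 2)) ^ 2 / 2 + c * (y * x) + v / 2 - c * (z * y) =
      (x - q * (z + y) / 2) * (A ^ 2 * q * (z + y) / 2 + c * y) := by
  have hx2 : x ^ 2 = 1 := by rcases hx with h | h <;> simp [h]
  have hy2 : y ^ 2 = 1 := by rcases hy with h | h <;> simp [h]
  have hz2 : z ^ 2 = 1 := by rcases hz with h | h <;> simp [h]
  linear_combination (-A ^ 2 / 2) * hx2 + (A ^ 2 * q ^ 2 / 8 + c * q / 2) * hy2 +
    (A ^ 2 * q ^ 2 / 8) * hz2 - y * z / 2 * hc + hv / 2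

/-- Convergence of characteristic functions to that of the standard normal law implies convergence
in distribution. -/
lemma tendstoInDistribution_gaussian_of_charFun {Ω : Type*} [MeasurableSpace Ω] {μ : Measure Ω}
    [IsProbabilityMeasure μ] {f : ℕ → Ω → ℝ} (hf : ∀ n, Measurable (f n))
    (h : ∀ t : ℝ, Tendsto (fun n => ∫ ω, Complex.exp (Complex.I * (t * f n ω : ℝ)) ∂μ) atTop
      (𝓝 (Complex.exp (-(t ^ 2 / 2 : ℝ))))) :
    TendstoInDistribution μ f (gaussianReal 0 1) := by
  let P : ℕ → ProbabilityMeasure ℝ := fun n =>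
    ⟨μ.map (f n), Measure.isProbabilityMeasure_map (hf n).aemeasurable⟩
  let ν : ProbabilityMeasure ℝ := ⟨gaussianReal 0 1, inferInstance⟩
  have hP : Tendsto P atTop (𝓝 ν) := by
    refine ProbabilityMeasure.tendsto_of_tendsto_charFun fun t => ?_
    have hν : charFun (ν : Measure ℝ) t = Complex.exp (-(t ^ 2 / 2 : ℝ)) := by
      change charFun (gaussianReal 0 1) t = _
      rw [charFun_gaussianReal]
      simp
    rw [hν]
    refine (h t).congr fun n => ?_
    change _ = charFun (μ.map (f n)) t
    rw [charFun_apply_real, integral_map (hf n).aemeasurable (by fun_prop)]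
    refine integral_congr_ae (ae_of_all _ fun ω => ?_)
    simp only
    congr 1
    push_cast
    ring
  intro g
  refine (ProbabilityMeasure.tendsto_iff_forall_integral_tendsto.1 hP g).congr fun n => ?_
  exact integral_map (hf n).aemeasurable g.continuous.aestronglyMeasurable

/-- for the elephant random walk remembering only the two most recent steps,
started at `X₁ = 1`: `Sₙ/n → 0` a.s., and `Sₙ/(σ₂√n) → N(0,1)` in distribution, where
`σ₂² = 1 + (2p-1)(5-2p)/(2(1-p)(3-2p))`. -/
theorem elephant_last_two_steps_limits
    {Ω : Type*} [MeasurableSpace Ω] (μ : Measure Ω) [IsProbabilityMeasure μ]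
    (p : ℝ) (hp0 : 0 < p) (hp1 : p < 1)
    (X : ℕ → Ω → ℝ)
    (hXmeas : ∀ i, Measurable (X i))
    (hval : ∀ i, 1 ≤ i → ∀ᵐ ω ∂μ, X i ω = 1 ∨ X i ω = -1)
    (hinit : ∀ᵐ ω ∂μ, X 1 ω = 1)
    (hcond1 : μ[X 2 | sigmaUpTo X 1] =ᵐ[μ] fun ω => (2*p-1) * X 1 ω)
    (hcond : ∀ n, 2 ≤ n →
      μ[X (n+1) | sigmaUpTo X n] =ᵐ[μ] fun ω => (2*p-1) * (X (n-1) ω + X n ω) / 2) :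
    (∀ᵐ ω ∂μ, Tendsto (fun n : ℕ => partialSum X n ω / n) atTop (𝓝 0)) ∧
    TendstoInDistribution μ
      (fun n ω => partialSum X n ω /
        (Real.sqrt (1 + (2*p-1)*(5-2*p)/(2*(1-p)*(3-2*p))) * Real.sqrt n))
      (gaussianReal 0 1) := by
  set q : ℝ := 2 * p - 1 with hq
  have hq1 : q < 1 := by linarith
  have hq2 : -1 < q := by linarith
  have hqa : |q| ≤ 1 := abs_le.2 ⟨hq2.le, hq1.le⟩
  set A : ℝ := (1 - q)⁻¹ with hA
  have hA0 : 0 < A := inv_pos.2 (by linarith)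
  set K : ℝ := 2 + 2 * A with hKdef
  have hcondk : ∀ k, μ[X (k + 3) | sigmaUpTo X (k + 2)] =ᵐ[μ]
      fun ω => q * (X (k + 1) ω + X (k + 2) ω) / 2 := fun k => hcond (k + 2) (by omega)
  have habs : ∀ i, 1 ≤ i → ∀ᵐ ω ∂μ, |X i ω| ≤ 1 := fun i hi => by
    filter_upwards [hval i hi] with ω h
    rcases h with h | h <;> simp [h]
  have hSmeas : ∀ k, Measurable (partialSum X k) := fun k =>
    Finset.measurable_fun_sum _ fun i _ => hXmeas i
  have hVmeas : ∀ k, Measurable (correctedWalk X q k) := fun k =>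
    ((stronglyMeasurable_correctedWalk X q k).mono (sigmaUpTo_le hXmeas _)).measurable
  have hSV : ∀ k, ∀ᵐ ω ∂μ, |partialSum X k ω - correctedWalk X q k ω| ≤ K := fun k => by
    filter_upwards [habs (k + 1) (by omega), habs (k + 2) (by omega)] with ω h1 h2
    have b1 : |q * A * X (k + 2) ω| ≤ A := by
      rw [abs_mul, abs_mul, abs_of_pos hA0]
      have : |q| * A * |X (k + 2) ω| ≤ 1 * A * 1 := by gcongr
      linarith
    have b2 : |q * A * X (k + 1) ω| ≤ A := by
      rw [abs_mul, abs_mul, abs_of_pos hA0]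
      have : |q| * A * |X (k + 1) ω| ≤ 1 * A * 1 := by gcongr
      linarith
    simp only [correctedWalk, partialSum_succ, div_eq_mul_inv q, ← hA]
    rw [abs_le] at *
    constructor <;> linarith
  have hV0 : ∀ᵐ ω ∂μ, |correctedWalk X q 0 ω| ≤ K := by
    filter_upwards [hSV 0] with ω h
    simpa [partialSum] using h
  have hD : ∀ k, ∀ᵐ ω ∂μ, |correctedWalk X q (k + 1) ω - correctedWalk X q k ω| ≤ K := fun k => by
    filter_upwards [habs (k + 1) (by omega), habs (k + 2) (by omega), habs (k + 3) (by omega)]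
      with ω h1 h2 h3
    rw [correctedWalk_succ_sub X hq1, ← hA, abs_mul, abs_of_pos hA0]
    have b : |innovation X q k ω| ≤ 2 := by
      have hq' : |q * (X (k + 1) ω + X (k + 2) ω)| ≤ 2 := by
        rw [abs_mul]
        have h12 := abs_add_le (X (k + 1) ω) (X (k + 2) ω)
        have := mul_le_mul hqa (h12.trans (add_le_add h1 h2)) (abs_nonneg _) zero_le_one
        linarith
      rw [innovation]
      rw [abs_le] at *
      constructor <;> linarith
    nlinarith
  constructor
  · have hbd := ae_abs_le_of_bounded_increments hV0 hD
    have horth : ∀ m k, ∫ ω, correctedWalk X q k ω ^ m *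
        (correctedWalk X q (k + 1) ω - correctedWalk X q k ω) ∂μ = 0 := fun m k => by
      have h := integral_innovation_smul_eq_zero (q := q) hXmeas hval (hcondk k)
        ((stronglyMeasurable_correctedWalk X q k).pow m) (C := (K * (k + 1)) ^ m) <| by
          filter_upwards [hbd k] with ω h
          rw [Pi.pow_apply, norm_pow, Real.norm_eq_abs]
          gcongr
      simp_rw [correctedWalk_succ_sub X hq1]
      rw [← mul_zero (1 - q)⁻¹, ← h, ← integral_const_mul]
      refine integral_congr_ae (ae_of_all _ fun ω => ?_)
      simp only [smul_eq_mul, Pi.pow_apply]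
      ring
    have hlim := ae_tendsto_div_of_orthogonal_increments hVmeas hV0 hD
      (fun k => by simpa using horth 1 k) (horth 3)
    filter_upwards [hlim, ae_all_iff.2 hSV] with ω h hω
    have hK0 : Tendsto (fun n : ℕ => K / (n : ℝ)) atTop (𝓝 0) :=
      tendsto_const_nhds.div_atTop tendsto_natCast_atTop_atTop
    have hdiff : Tendsto (fun n : ℕ => (partialSum X n ω - correctedWalk X q n ω) / n) atTop
        (𝓝 0) := by
      refine squeeze_zero_norm (fun n => ?_) hK0
      rw [norm_div, Real.norm_eq_abs, Real.norm_natCast]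
      gcongr
      exact hω n
    have hratio : Tendsto (fun n : ℕ => 1 + 1 / (n : ℝ)) atTop (𝓝 1) := by
      simpa using tendsto_one_div_atTop_nhds_zero_nat.const_add (1 : ℝ)
    have hsum := (h.mul hratio).add hdiff
    simp only [zero_mul, add_zero] at hsum
    refine hsum.congr' ?_
    filter_upwards [eventually_gt_atTop 0] with n hn
    have : (0 : ℝ) < n := Nat.cast_pos.2 hn
    field_simp
    ring
  · have h2q : 2 - q ≠ 0 := by linarith
    have h1q : 1 - q ≠ 0 := by linarith
    set c : ℝ := A ^ 2 * q ^ 2 / 2 / (2 - q) with hcdef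
    have hc : c * (2 - q) = A ^ 2 * q ^ 2 / 2 := div_mul_cancel₀ _ h2q
    set v : ℝ := 1 + q * (5 - 2 * p) / (2 * (1 - p) * (3 - 2 * p)) with hvdef
    have hv : v = A ^ 2 * (1 - q ^ 2 / 2) - c * q := by
      rw [hvdef, hcdef, hA, show 5 - 2 * p = 4 - q by linarith, show 3 - 2 * p = 2 - q by linarith,
        show 2 * (1 - p) = 1 - q by linarith]
      field_simp
      ring
    have hvpos : 0 < v := by
      have : v = (2 + q) / ((1 - q) * (2 - q)) := by
        rw [hvdef, show 5 - 2 * p = 4 - q by linarith, show 3 - 2 * p = 2 - q by linarith,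
          show 2 * (1 - p) = 1 - q by linarith]
        field_simp
        ring
      rw [this]
      exact div_pos (by linarith) (mul_pos (by linarith) (by linarith))
    have hclt := tendsto_integral_exp_of_corrected_increments (μ := μ) (U := partialSum X)
      (V := correctedWalk X q) (Y := fun k ω => X (k + 1) ω * X (k + 2) ω) (K := K) (c := c)
      (v := v) (by positivity) hvpos.le hSmeas hVmeas
      (fun k => (hXmeas _).mul (hXmeas _)) hSV hV0 hD
      (fun k => by
        filter_upwards [habs (k + 1) (by omega), habs (k + 2) (by omega)] with ω h1 h2
        rw [abs_mul]
        exact mul_le_one₀ h1 (abs_nonneg _) h2)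
      (fun k s => by
        have hy := stronglyMeasurable_sigmaUpTo X (show 1 ≤ k + 2 by omega) le_rfl
        have hz := stronglyMeasurable_sigmaUpTo X (show 1 ≤ k + 1 by omega)
          (show k + 1 ≤ k + 2 by omega)
        have hexp : StronglyMeasurable[sigmaUpTo X (k + 2)] fun ω =>
            Complex.exp (Complex.I * (s * correctedWalk X q k ω : ℝ)) :=
          (by fun_prop : Continuous fun x : ℝ =>
            Complex.exp (Complex.I * (s * x : ℝ))).comp_stronglyMeasurable
            (stronglyMeasurable_correctedWalk X q k)
        have hpoly : StronglyMeasurable[sigmaUpTo X (k + 2)] fun ω =>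
            Complex.I * (s * A : ℝ) +
              (s ^ 2 * (A ^ 2 * q * (X (k + 1) ω + X (k + 2) ω) / 2 + c * X (k + 2) ω) : ℝ) :=
          (by fun_prop : Continuous fun x : ℝ × ℝ => Complex.I * (s * A : ℝ) +
              (s ^ 2 * (A ^ 2 * q * (x.1 + x.2) / 2 + c * x.2) : ℝ)).comp_stronglyMeasurable
            (hz.prodMk hy)
        have h := integral_innovation_smul_eq_zero (q := q) hXmeas hval (hcondk k)
          (hexp.mul hpoly)
          (C := |s * A| + s ^ 2 * (A ^ 2 * |q| + |c|)) <| by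
            filter_upwards [habs (k + 1) (by omega), habs (k + 2) (by omega)] with ω h1 h2
            rw [Pi.mul_apply, norm_mul, Complex.norm_exp_I_mul_ofReal, one_mul]
            refine (norm_add_le _ _).trans (add_le_add ?_ ?_)
            · rw [norm_mul, Complex.norm_I, one_mul, Complex.norm_real, Real.norm_eq_abs]
            · rw [Complex.norm_real, Real.norm_eq_abs, abs_mul, abs_pow, sq_abs]
              gcongr
              refine (abs_add_le _ _).trans (add_le_add ?_ ?_)
              · rw [abs_div, abs_mul, abs_mul, abs_pow, sq_abs, abs_two]
                have h12 := (abs_add_le (X (k + 1) ω) (X (k + 2) ω)).trans (add_le_add h1 h2)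
                have : A ^ 2 * |q| * |X (k + 1) ω + X (k + 2) ω| ≤ A ^ 2 * |q| * (1 + 1) := by
                  gcongr
                linarith
              · rw [abs_mul]
                exact mul_le_of_le_one_right (abs_nonneg _) h2
        rw [← h]
        refine integral_congr_ae ?_
        filter_upwards [hval (k + 1) (by omega), hval (k + 2) (by omega), hval (k + 3) (by omega)]
          with ω hz hy hx
        have key := second_order_term_eq hc hv hx hy hz
        rw [correctedWalk_succ_sub X hq1, ← hA]
        simp only [innovation, Pi.mul_apply, Complex.real_smul, add_assoc, Nat.reduceAdd]
        simp only [add_assoc] at key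
        rw [key]
        push_cast
        ring)
    have hσ : 0 < √v := Real.sqrt_pos.2 hvpos
    refine tendstoInDistribution_gaussian_of_charFun (fun n => (hSmeas n).div_const _) fun t => ?_
    have h := hclt (t / √v)
    rw [show v * (t / √v) ^ 2 / 2 = t ^ 2 / 2 by
      rw [div_pow, Real.sq_sqrt hvpos.le]; field_simp] at h
    refine h.congr fun n => ?_
    congr 1 with ω
    congr 3
    ring
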